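/- Let S be a countable set and let Q = (q(i,j))_{i,j∈S} be an irreducible proper Q-matrix on S that has a stationary distribution vector π with π(j) > 0 for all j, and assume that every subinvariant measure of Q is a positive scalar multiple of π. For each n ∈ ℕ let Q_n be a proper Q-matrix on S having a stationary distribution vector π_n, and assume lim_{n→∞} q_n(i,j) = q(i,j) for all i, j ∈ S. Then for every j ∈ S, limsup_{n→∞} π_n(j) ≤ π(j) and liminf_{n→∞} π_n(j) ≤ π(j). -/

import Mathlib

/-- A proper (stable and conservative) Q-matrix on a countable state space. -/
def IsProperQMatrix {S : Type*} (q : S → S → ℝ) : Prop :=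
  (∀ i, q i i ≤ 0) ∧ (∀ i j, i ≠ j → 0 ≤ q i j) ∧
  (∀ i, Summable (fun j : {j : S // j ≠ i} => q i (j : S)) ∧
    (∑' j : {j : S // j ≠ i}, q i (j : S)) = -q i i)

/-- Irreducibility: any two distinct states are connected by a finite path of
positive transition rates. -/
def IsIrreducibleQ {S : Type*} (q : S → S → ℝ) : Prop :=
  ∀ i j : S, i ≠ j → ∃ m : ℕ, 1 ≤ m ∧ ∃ c : ℕ → S, c 0 = i ∧ c m = j ∧
    ∀ r < m, 0 < q (c r) (c (r + 1))

/-- A subinvariant measure of a proper Q-matrix: nonnegative, not identically zero,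
with `∑_{i ≠ j} μ i * q i j ≤ -(μ j * q j j)` for every `j`. -/
def IsSubinvariantMeasure {S : Type*} (q : S → S → ℝ) (μ : S → ℝ) : Prop :=
  (∀ i, 0 ≤ μ i) ∧ μ ≠ 0 ∧
  ∀ j, Summable (fun i : {i : S // i ≠ j} => μ (i : S) * q (i : S) j) ∧
    (∑' i : {i : S // i ≠ j}, μ (i : S) * q (i : S) j) ≤ -(μ j * q j j)

/-- An invariant measure of a proper Q-matrix: nonnegative, not identically zero,
with `∑_{i ≠ j} μ i * q i j = -(μ j * q j j)` for every `j`. -/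
def IsInvariantMeasure {S : Type*} (q : S → S → ℝ) (μ : S → ℝ) : Prop :=
  (∀ i, 0 ≤ μ i) ∧ μ ≠ 0 ∧
  ∀ j, Summable (fun i : {i : S // i ≠ j} => μ (i : S) * q (i : S) j) ∧
    (∑' i : {i : S // i ≠ j}, μ (i : S) * q (i : S) j) = -(μ j * q j j)

/-- A stationary distribution vector of a proper Q-matrix: a probability vector `π`
with `∑_{i ≠ j} π i * q i j = -(π j * q j j)` for every `j`. -/
def IsStationaryDistVec {S : Type*} (q : S → S → ℝ) (π : S → ℝ) : Prop :=
  (∀ j, 0 ≤ π j) ∧ Summable π ∧ (∑' j, π j) = 1 ∧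
  ∀ j, Summable (fun i : {i : S // i ≠ j} => π (i : S) * q (i : S) j) ∧
    (∑' i : {i : S // i ≠ j}, π (i : S) * q (i : S) j) = -(π j * q j j)

open Filter

/-- A family of functions with values in the unit interval has, along any ultrafilter, a pointwise limit. -/
theorem exists_pointwise_limit_of_mem_Icc {ι S : Type*} (U : Ultrafilter ι) (f : ι → S → ℝ)
    (hf : ∀ n j, f n j ∈ Set.Icc (0 : ℝ) 1) :
    ∃ μ : S → ℝ, (∀ j, 0 ≤ μ j) ∧ ∀ j, Tendsto (fun n => f n j) U (nhds (μ j)) := by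
  have key : ∀ j, ∃ x ∈ Set.Icc (0 : ℝ) 1, Tendsto (fun n => f n j) U (nhds x) := fun j =>
    isCompact_Icc.ultrafilter_le_nhds (U.map fun n => f n j)
      (le_principal_iff.2 (mem_map.2 (Eventually.of_forall fun n => hf n j)))
  choose μ hμ hlim using key
  exact ⟨μ, fun j => (hμ j).1, hlim⟩

/-- Entries of a stationary distribution vector lie in the unit interval. -/
theorem IsStationaryDistVec.mem_Icc {S : Type*} {q : S → S → ℝ} {π : S → ℝ}
    (hπ : IsStationaryDistVec q π) (j : S) : π j ∈ Set.Icc (0 : ℝ) 1 :=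
  ⟨hπ.1 j, hπ.2.2.1 ▸ hπ.2.1.le_tsum j fun i _ => hπ.1 i⟩

/-- A nonzero pointwise limit of stationary distribution vectors of entrywise converging proper
Q-matrices is a subinvariant measure of the limiting Q-matrix. -/
theorem isSubinvariantMeasure_of_tendsto {ι S : Type*} {l : Filter ι} [l.NeBot]
    {q : S → S → ℝ} {qn : ι → S → S → ℝ} {πn : ι → S → ℝ} {μ : S → ℝ}
    (hq : IsProperQMatrix q) (hqn : ∀ n, IsProperQMatrix (qn n))
    (hπn : ∀ n, IsStationaryDistVec (qn n) (πn n))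
    (hconv : ∀ i j, Tendsto (fun n => qn n i j) l (nhds (q i j)))
    (hμ : ∀ j, Tendsto (fun n => πn n j) l (nhds (μ j)))
    (hμ_nonneg : ∀ j, 0 ≤ μ j) (hμ_ne : μ ≠ 0) : IsSubinvariantMeasure q μ := by
  refine ⟨hμ_nonneg, hμ_ne, fun j => ?_⟩
  have hnonneg : ∀ i : {i : S // i ≠ j}, 0 ≤ μ i * q i j :=
    fun i => mul_nonneg (hμ_nonneg i) (hq.2.1 i j i.2)
  have hfin : ∀ F : Finset {i : S // i ≠ j}, ∑ i ∈ F, μ i * q i j ≤ -(μ j * q j j) := fun F => by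
    refine le_of_tendsto_of_tendsto'
      (tendsto_finsetSum F fun i _ => (hμ i).mul (hconv i j)) ((hμ j).mul (hconv j j)).neg
      fun n => ?_
    obtain ⟨hs, he⟩ := (hπn n).2.2.2 j
    exact he ▸ hs.sum_le_tsum F fun i _ => mul_nonneg ((hπn n).1 i) ((hqn n).2.1 i j i.2)
  have hs := summable_of_sum_le hnonneg hfin
  exact ⟨hs, hs.tsum_le_of_sum_le hfin⟩

/-- A step in the proof of Theorem B.1: under entrywise convergence of the proper
Q-matrices `qn n` to the ergodic proper Q-matrix `q`, the limsup and liminf of each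
entry of the stationary distribution vectors `πn n` are bounded by `π`. -/
theorem stmt12 {S : Type*} [Countable S] (q : S → S → ℝ)
    (hq : IsProperQMatrix q) (hirr : IsIrreducibleQ q)
    (π : S → ℝ) (hπ : IsStationaryDistVec q π) (hπpos : ∀ j, 0 < π j)
    (huniq : ∀ μ : S → ℝ, IsSubinvariantMeasure q μ →
      ∃ c : ℝ, 0 < c ∧ ∀ j, μ j = c * π j)
    (qn : ℕ → S → S → ℝ) (hqn : ∀ n, IsProperQMatrix (qn n))
    (πn : ℕ → S → ℝ) (hπn : ∀ n, IsStationaryDistVec (qn n) (πn n))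
    (hconv : ∀ i j, Tendsto (fun n => qn n i j) atTop (nhds (q i j))) :
    ∀ j, limsup (fun n => πn n j) atTop ≤ π j ∧
      liminf (fun n => πn n j) atTop ≤ π j := by
  have hle : ∀ (U : Ultrafilter ℕ), (U : Filter ℕ) ≤ atTop → ∀ j, ∃ x ≤ π j,
      Tendsto (fun n => πn n j) U (nhds x) := by
    intro U hU j
    obtain ⟨μ, hμ_nonneg, hμ⟩ :=
      exists_pointwise_limit_of_mem_Icc U πn fun n j => (hπn n).mem_Icc j
    refine ⟨μ j, ?_, hμ j⟩
    rcases eq_or_ne μ 0 with rfl | hμ_ne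
    · exact (hπpos j).le
    obtain ⟨c, -, hc⟩ := huniq μ (isSubinvariantMeasure_of_tendsto hq hqn hπn
      (fun i j => (hconv i j).mono_left hU) hμ hμ_nonneg hμ_ne)
    have hsum : ∀ F : Finset S, ∑ i ∈ F, μ i ≤ 1 := fun F =>
      le_of_tendsto' (tendsto_finsetSum F fun i _ => hμ i) fun n =>
        (hπn n).2.2.1 ▸ (hπn n).2.1.sum_le_tsum F fun i _ => (hπn n).1 i
    have hc_le : c ≤ 1 := by
      have h := (summable_of_sum_le hμ_nonneg hsum).tsum_le_of_sum_le hsum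
      simpa only [hc, tsum_mul_left, hπ.2.2.1, mul_one] using h
    rw [hc j]
    exact mul_le_of_le_one_left (hπpos j).le hc_le
  intro j
  have hbdd_above : IsBoundedUnder (· ≤ ·) atTop fun n => πn n j :=
    isBoundedUnder_of ⟨1, fun n => ((hπn n).mem_Icc j).2⟩
  have hbdd_below : IsBoundedUnder (· ≥ ·) atTop fun n => πn n j :=
    isBoundedUnder_of ⟨0, fun n => (hπn n).1 j⟩
  have hlimsup : limsup (fun n => πn n j) atTop ≤ π j := by
    by_contra! hlt
    obtain ⟨b, hb, hb'⟩ := exists_between hlt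
    have hfreq : ∃ᶠ n in atTop, b < πn n j :=
      frequently_lt_of_lt_limsup hbdd_below.isCoboundedUnder_le hb'
    have : (atTop ⊓ principal {n | b < πn n j}).NeBot := frequently_mem_iff_neBot.1 hfreq
    have hU := Ultrafilter.of_le (atTop ⊓ principal {n | b < πn n j})
    obtain ⟨x, hx, hlim⟩ := hle _ (hU.trans inf_le_left) j
    have hbx : b ≤ x := ge_of_tendsto hlim
      (Eventually.mono (le_principal_iff.1 (hU.trans inf_le_right)) fun n hn => le_of_lt hn)
    linarith
  exact ⟨hlimsup, (liminf_le_limsup hbdd_above hbdd_below).trans hlimsup⟩
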